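/- There exists a constant δ > 0 such that for every n ≥ 1 and all multi-indices α, β ∈ ℕⁿ not both zero, |cos d(α,β)| = |B(α,β)| ≤ 1 − δ · (Σ_{j=1}^n |α_j − β_j|) / (|α| + |β|). -/

import Mathlib

open Finset

/-- The constant `A(α,β)` of Definition 1: if every `α_j + β_j` is even, with
`σ_j = (α_j + β_j)/2`, it is `(−1)^{(|α|−|β|)/2} · Π_j (2σ_j)! / (2^{σ_j} σ_j!)`;
if some `α_j + β_j` is odd it is `0`. -/
noncomputable def Acoef (n : ℕ) (α β : Fin n → ℕ) : ℝ :=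
  if ∀ j, Even (α j + β j) then
    (-1 : ℝ) ^ (((∑ j, (α j : ℤ)) - ∑ j, (β j : ℤ)) / 2) *
      ∏ j, ((α j + β j).factorial : ℝ) /
        (2 ^ ((α j + β j) / 2) * (((α j + β j) / 2).factorial : ℝ))
  else 0

/-- The normalized constant `B(α,β) = A(α,β) / (A(α,α) · A(β,β))^{1/2}`. -/
noncomputable def Bcoef (n : ℕ) (α β : Fin n → ℕ) : ℝ :=
  Acoef n α β / Real.sqrt (Acoef n α α * Acoef n β β)

/-- The angle distance `d(α,β) = arccos (B(α,β))` on the lattice `ℕⁿ`. -/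
noncomputable def dAngle (n : ℕ) (α β : Fin n → ℕ) : ℝ :=
  Real.arccos (Bcoef n α β)

noncomputable def DD (t : ℕ) : ℝ := ((2 * t).factorial : ℝ) / (2 ^ t * (t.factorial : ℝ))

lemma DD_pos (t : ℕ) : 0 < DD t := by unfold DD; positivity

lemma DD_succ (t : ℕ) : DD (t + 1) = (2 * t + 1) * DD t := by
  unfold DD
  rw [show 2 * (t + 1) = 2 * t + 1 + 1 by ring, Nat.factorial_succ, Nat.factorial_succ,
    Nat.factorial_succ]
  push_cast
  field_simp
  ring

lemma DD_key (k : ℕ) : ∀ c : ℕ,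
    DD (c + k) ^ 2 * ((c : ℝ) + 2 * k) ≤ ((c : ℝ) + k) * (DD (c + 2 * k) * DD c) := by
  induction k with
  | zero => intro c; simp; nlinarith
  | succ k ih =>
    intro c
    have h := ih (c + 1)
    rw [show c + 1 + k = c + (k + 1) by ring, DD_succ c] at h
    rw [show c + 2 * (k + 1) = (c + 1 + 2 * k) + 1 by ring, DD_succ (c + 1 + 2 * k)]
    have hX := DD_pos (c + 1 + 2 * k)
    have hY := DD_pos c
    set X := DD (c + 1 + 2 * k)
    set Y := DD c
    set Z := DD (c + (k + 1))
    push_cast at h ⊢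
    have hc : (0 : ℝ) ≤ c := by positivity
    have hk : (0 : ℝ) ≤ k := by positivity
    have hp : (0 : ℝ) < (c : ℝ) + 1 + 2 * k := by positivity
    refine le_of_mul_le_mul_right ?_ hp
    have h1 : ((2 * c + 1) * (c + 2 * k + 2) : ℝ) ≤ (2 * c + 4 * k + 3) * (c + 2 * k + 1) := by
      nlinarith [mul_nonneg hc hk, mul_nonneg hk hk]
    have h2 := mul_le_mul_of_nonneg_left h (show (0 : ℝ) ≤ c + 2 * k + 2 by positivity)
    have h3 := mul_le_mul_of_nonneg_left h1
      (show (0 : ℝ) ≤ ((c : ℝ) + 1 + k) * (X * Y) by positivity)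
    linarith

noncomputable def rr (a b : ℕ) : ℝ := DD ((a + b) / 2) / Real.sqrt (DD a * DD b)

lemma rr_nonneg (a b : ℕ) : 0 ≤ rr a b :=
  div_nonneg (DD_pos _).le (Real.sqrt_nonneg _)

lemma rr_comm (a b : ℕ) : rr a b = rr b a := by
  unfold rr; rw [add_comm, mul_comm]

lemma rr_aux (c k : ℕ) :
    rr (c + 2 * k) c * (2 * (c + k)) ≤ 2 * (c + k) - k / 2 := by
  unfold rr
  rw [show (c + 2 * k + c) / 2 = c + k by omega]
  have h := DD_key k c
  have hX := DD_pos (c + 2 * k)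
  have hY := DD_pos c
  have hW : 0 < DD (c + 2 * k) * DD c := by positivity
  set W := DD (c + 2 * k) * DD c
  have hZ := DD_pos (c + k)
  set Z := DD (c + k)
  have hc : (0 : ℝ) ≤ c := by positivity
  have hk : (0 : ℝ) ≤ k := by positivity
  rw [div_mul_eq_mul_div, div_le_iff₀ (Real.sqrt_pos.2 hW)]
  have hy : (0 : ℝ) ≤ 2 * (c + k) - k / 2 := by linarith
  rcases (add_nonneg hc hk).eq_or_lt with h0 | h0
  · have : (k : ℝ) = 0 := by linarith
    rw [← h0, this]; simp
  · refine (pow_le_pow_iff_left₀ (by positivity) (by positivity) two_ne_zero).1 ?_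
    rw [mul_pow, mul_pow _ (Real.sqrt W), Real.sq_sqrt hW.le]
    have hp : (0 : ℝ) < c + 2 * k := by linarith
    refine le_of_mul_le_mul_right ?_ hp
    have h1 : ((c : ℝ) + k) * (2 * (c + k)) ^ 2 ≤ (2 * (c + k) - k / 2) ^ 2 * (c + 2 * k) := by
      nlinarith [mul_nonneg hc hk, mul_nonneg hk hk, mul_nonneg hc (mul_nonneg hc hk),
        mul_nonneg hc (mul_nonneg hk hk), mul_nonneg hk (mul_nonneg hk hk)]
    have h2 := mul_le_mul_of_nonneg_right h (show (0 : ℝ) ≤ (2 * (c + k)) ^ 2 by positivity)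
    have h3 := mul_le_mul_of_nonneg_right h1 hW.le
    linarith

lemma rr_bound (a b : ℕ) (h : Even (a + b)) :
    rr a b * ((a : ℝ) + b) ≤ (a + b) - |(a : ℝ) - b| / 4 := by
  wlog hab : b ≤ a generalizing a b
  · have := this b a (by rwa [add_comm]) (by omega)
    rw [rr_comm, abs_sub_comm, add_comm (a : ℝ)]; exact this
  obtain ⟨k, rfl⟩ : ∃ k, a = b + 2 * k := by
    obtain ⟨m, hm⟩ := h
    exact ⟨m - b, by omega⟩
  have := rr_aux b k
  push_cast
  rw [show (b : ℝ) + 2 * k - b = 2 * k by ring, abs_of_nonneg (by positivity)]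
  convert this using 1 <;> ring

lemma rr_le_one (a b : ℕ) (h : Even (a + b)) : rr a b ≤ 1 := by
  rcases Nat.eq_zero_or_pos (a + b) with h0 | h0
  · obtain ⟨rfl, rfl⟩ : a = 0 ∧ b = 0 := by omega
    simp [rr, DD]
  · have := rr_bound a b h
    have hp : (0 : ℝ) < (a : ℝ) + b := by exact_mod_cast h0
    have := abs_nonneg ((a : ℝ) - b)
    refine le_of_mul_le_mul_right ?_ hp
    linarith

lemma Acoef_even (n : ℕ) (α β : Fin n → ℕ) (h : ∀ j, Even (α j + β j)) :
    |Acoef n α β| = ∏ j, DD ((α j + β j) / 2) := by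
  unfold Acoef
  rw [if_pos h, abs_mul, abs_zpow, abs_neg, abs_one, one_zpow, one_mul, abs_of_nonneg]
  · refine Finset.prod_congr rfl fun j _ => ?_
    rw [DD, Nat.mul_div_cancel' (h j).two_dvd]
  · positivity

lemma Acoef_self (n : ℕ) (α : Fin n → ℕ) : Acoef n α α = ∏ j, DD (α j) := by
  have h := Acoef_even n α α (fun j => ⟨_, rfl⟩)
  rw [abs_of_nonneg] at h
  · rw [h]
    refine Finset.prod_congr rfl fun j _ => ?_
    congr 1; omega
  · unfold Acoef
    rw [if_pos (fun j => ⟨_, rfl⟩), sub_self]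
    simp only [Int.zero_ediv, zpow_zero, one_mul]
    positivity

lemma Bcoef_even (n : ℕ) (α β : Fin n → ℕ) (h : ∀ j, Even (α j + β j)) :
    |Bcoef n α β| = ∏ j, rr (α j) (β j) := by
  unfold Bcoef rr
  rw [abs_div, Acoef_even n α β h, Acoef_self, Acoef_self, abs_of_nonneg (Real.sqrt_nonneg _),
    Finset.prod_div_distrib, ← Finset.prod_mul_distrib,
    Real.sqrt_prod _ (fun j _ => (mul_pos (DD_pos _) (DD_pos _)).le)]

lemma Bcoef_coord (n : ℕ) (α β : Fin n → ℕ) (j : Fin n) :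
    |Bcoef n α β| * ((α j : ℝ) + β j) ≤ (α j + β j) - |(α j : ℝ) - β j| / 4 := by
  by_cases h : ∀ j, Even (α j + β j)
  · refine le_trans ?_ (rr_bound _ _ (h j))
    refine mul_le_mul_of_nonneg_right ?_ (by positivity)
    rw [Bcoef_even n α β h, ← Finset.mul_prod_erase _ _ (Finset.mem_univ j)]
    refine mul_le_of_le_one_right (rr_nonneg _ _) ?_
    exact Finset.prod_le_one (fun i _ => rr_nonneg _ _) (fun i _ => rr_le_one _ _ (h i))
  · have : Bcoef n α β = 0 := by simp [Bcoef, Acoef, if_neg h]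
    rw [this, abs_zero, zero_mul]
    have ha : (0 : ℝ) ≤ α j := by positivity
    have hb : (0 : ℝ) ≤ β j := by positivity
    have : |(α j : ℝ) - β j| ≤ α j + β j := abs_le.2 ⟨by linarith, by linarith⟩
    linarith

theorem dAngle_distance_comparison :
    ∃ δ : ℝ, 0 < δ ∧ ∀ (n : ℕ), 1 ≤ n → ∀ α β : Fin n → ℕ, ¬(α = 0 ∧ β = 0) →
      |Real.cos (dAngle n α β)| = |Bcoef n α β|
      ∧ |Bcoef n α β|
          ≤ 1 - δ * (∑ j, |(α j : ℝ) - (β j : ℝ)|) / ((∑ j, (α j : ℝ)) + ∑ j, (β j : ℝ)) := by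
  refine ⟨1 / 4, by norm_num, fun n _ α β h0 => ?_⟩
  have hS : 0 < (∑ j, (α j : ℝ)) + ∑ j, (β j : ℝ) := by
    rw [← Finset.sum_add_distrib]
    by_contra hcon
    have hz := le_antisymm (not_lt.1 hcon) (Finset.sum_nonneg fun j _ => by positivity)
    rw [Finset.sum_eq_zero_iff_of_nonneg (fun j _ => by positivity)] at hz
    apply h0
    constructor <;> funext j <;> have hj := hz j (Finset.mem_univ j) <;> norm_cast at hj <;>
      simp only [Pi.zero_apply] <;> omega
  have hsum := Finset.sum_le_sum (fun j (_ : j ∈ Finset.univ) => Bcoef_coord n α β j)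
  rw [← Finset.mul_sum, Finset.sum_sub_distrib, ← Finset.sum_div, Finset.sum_add_distrib] at hsum
  have hD : 0 ≤ ∑ j, |(α j : ℝ) - (β j : ℝ)| := Finset.sum_nonneg fun j _ => abs_nonneg _
  have hB : |Bcoef n α β|
      ≤ 1 - 1 / 4 * (∑ j, |(α j : ℝ) - (β j : ℝ)|) / ((∑ j, (α j : ℝ)) + ∑ j, (β j : ℝ)) := by
    rw [le_sub_iff_add_le, ← le_sub_iff_add_le', div_le_iff₀ hS]
    linarith
  refine ⟨?_, hB⟩
  have h1 : |Bcoef n α β| ≤ 1 := by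
    refine hB.trans ?_
    have : 0 ≤ 1 / 4 * (∑ j, |(α j : ℝ) - (β j : ℝ)|) / ((∑ j, (α j : ℝ)) + ∑ j, (β j : ℝ)) := by
      positivity
    linarith
  rw [dAngle, Real.cos_arccos (abs_le.1 h1).1 (abs_le.1 h1).2]
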